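/- Let a, c < 0, b, d > 0, and for s < −1/2, s' ∈ ℝ, let û₀ᴺ(ξ) = N^{−s} χ_{A_N}(ξ) with A_N = {ξ : N − 1/2 ≤ |ξ| ≤ N + 1/2}. Define Q(t, ξ) = (iξ/(2(1+dξ²))) ∫₀ᵗ ∫_ℝ [ (2(1+dξ²)h(ξ₁))/((1+bξ²)h(ξ)) sin(ξσ(ξ)(t−τ))(−sin(ξ₁σ(ξ₁)τ)) cos((ξ−ξ₁)σ(ξ−ξ₁)τ) + cos(ξσ(ξ)(t−τ)) cos(ξ₁σ(ξ₁)τ) cos((ξ−ξ₁)σ(ξ−ξ₁)τ) ] û₀ᴺ(ξ₁) û₀ᴺ(ξ−ξ₁) dξ₁ dτ, evaluated at t = 1/(100N). Then ‖⟨ξ⟩^{s'} Q(1/(100N), ·)‖_{L²(|ξ|≤1)} ≳ N^{−2s−1}, which tends to +∞ as N → ∞ when s < −1/2, while ‖u₀ᴺ‖_{H^s} ∼ 1. -/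

import Mathlib

open MeasureTheory

noncomputable def sigmaFn (a b c d ξ : ℝ) : ℝ :=
  Real.sqrt ((1 - a * ξ ^ 2) * (1 - c * ξ ^ 2) / ((1 + b * ξ ^ 2) * (1 + d * ξ ^ 2)))

noncomputable def hFn (a b c d ξ : ℝ) : ℝ :=
  Real.sqrt ((1 - a * ξ ^ 2) * (1 + d * ξ ^ 2) / ((1 - c * ξ ^ 2) * (1 + b * ξ ^ 2)))

noncomputable def uhat (s N ξ : ℝ) : ℝ :=
  N ^ (-s) * Set.indicator {ξ : ℝ | N - 1/2 ≤ |ξ| ∧ |ξ| ≤ N + 1/2} (fun _ => (1:ℝ)) ξ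

/-- The resonant bracket in the second Picard iterate of the 1D generic abcd system. -/
noncomputable def bracket (a b c d t τ ξ ξ₁ : ℝ) : ℝ :=
  (2 * (1 + d * ξ ^ 2) * hFn a b c d ξ₁) / ((1 + b * ξ ^ 2) * hFn a b c d ξ) *
      Real.sin (ξ * sigmaFn a b c d ξ * (t - τ)) *
      (-Real.sin (ξ₁ * sigmaFn a b c d ξ₁ * τ)) *
      Real.cos ((ξ - ξ₁) * sigmaFn a b c d (ξ - ξ₁) * τ)
    + Real.cos (ξ * sigmaFn a b c d ξ * (t - τ)) *
        Real.cos (ξ₁ * sigmaFn a b c d ξ₁ * τ) *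
        Real.cos ((ξ - ξ₁) * sigmaFn a b c d (ξ - ξ₁) * τ)

/-- The inner (time and frequency) integral of the second Picard iterate, evaluated at
time `t = 1/(100 N)`; the full iterate is `Q(t,ξ) = (iξ/(2(1+dξ²))) * I(N,ξ)`. -/
noncomputable def Iint (a b c d s N ξ : ℝ) : ℝ :=
  ∫ τ in Set.Icc (0:ℝ) (1 / (100 * N)),
    ∫ ξ₁ : ℝ, bracket a b c d (1 / (100 * N)) τ ξ ξ₁ * uhat s N ξ₁ * uhat s N (ξ - ξ₁)

namespace St16

lemma ratio_le {p q x : ℝ} (hp : 0 < p) (hq : 0 < q) (hx : 0 ≤ x) :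
    (1 + p * x) / (1 + q * x) ≤ 1 + p / q := by
  rw [div_le_iff₀ (by positivity)]
  have h1 : (1 + p / q) * (1 + q * x) = 1 + p / q + q * x + p * x := by
    field_simp
    ring
  rw [h1]
  have : 0 < p / q := by positivity
  have : 0 ≤ q * x := by positivity
  linarith

lemma sqrt_prod_le {p q r w x : ℝ} (hp : 0 < p) (hq : 0 < q) (hr : 0 < r) (hw : 0 < w)
    (hx : 0 ≤ x) :
    Real.sqrt ((1 + p * x) * (1 + q * x) / ((1 + r * x) * (1 + w * x)))
      ≤ Real.sqrt ((1 + p / r) * (1 + q / w)) := by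
  apply Real.sqrt_le_sqrt
  rw [mul_div_mul_comm]
  exact mul_le_mul (ratio_le hp hr hx) (ratio_le hq hw hx) (by positivity) (by positivity)

lemma sigma_bound (a b c d : ℝ) (ha : a < 0) (hc : c < 0) (hb : 0 < b) (hd : 0 < d) :
    ∃ K : ℝ, 0 ≤ K ∧ ∀ ξ, sigmaFn a b c d ξ ≤ K := by
  refine ⟨Real.sqrt ((1 + -a / b) * (1 + -c / d)), Real.sqrt_nonneg _, fun ξ => ?_⟩
  have := sqrt_prod_le (neg_pos.2 ha) (neg_pos.2 hc) hb hd (sq_nonneg ξ)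
  simp only [sigmaFn, sub_eq_add_neg, ← neg_mul]
  exact this

lemma coef_bound (a b c d : ℝ) (ha : a < 0) (hc : c < 0) (hb : 0 < b) (hd : 0 < d) :
    ∃ K : ℝ, 0 ≤ K ∧ ∀ ξ x : ℝ,
      |(2 * (1 + d * ξ ^ 2) * hFn a b c d x) / ((1 + b * ξ ^ 2) * hFn a b c d ξ)| ≤ K := by
  refine ⟨(2 * (1 + d / b)) * (Real.sqrt ((1 + -a / -c) * (1 + d / b)) *
    Real.sqrt ((1 + -c / -a) * (1 + b / d))), by
      have : 0 < d / b := by positivity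
      positivity, fun ξ x => ?_⟩
  have h1 : hFn a b c d x ≤ Real.sqrt ((1 + -a / -c) * (1 + d / b)) := by
    have := sqrt_prod_le (neg_pos.2 ha) hd (neg_pos.2 hc) hb (sq_nonneg x)
    simp only [hFn, sub_eq_add_neg, ← neg_mul]
    exact this
  have h2 : (hFn a b c d ξ)⁻¹ ≤ Real.sqrt ((1 + -c / -a) * (1 + b / d)) := by
    have := sqrt_prod_le (neg_pos.2 hc) hb (neg_pos.2 ha) hd (sq_nonneg ξ)
    simp only [hFn, sub_eq_add_neg, ← neg_mul]
    rw [← Real.sqrt_inv, inv_div]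
    exact this
  have h3 : (1 + d * ξ ^ 2) / (1 + b * ξ ^ 2) ≤ 1 + d / b := ratio_le hd hb (sq_nonneg ξ)
  have hn1 : 0 ≤ hFn a b c d x := Real.sqrt_nonneg _
  have hn2 : 0 ≤ hFn a b c d ξ := Real.sqrt_nonneg _
  rw [abs_of_nonneg (by positivity)]
  have e : (2 * (1 + d * ξ ^ 2) * hFn a b c d x) / ((1 + b * ξ ^ 2) * hFn a b c d ξ)
    = (2 * ((1 + d * ξ ^ 2) / (1 + b * ξ ^ 2))) * (hFn a b c d x * (hFn a b c d ξ)⁻¹) := by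
    rw [mul_div_mul_comm]
    simp only [div_eq_mul_inv]
    ring
  rw [e]
  gcongr

lemma sigma_tendsto (a b c d : ℝ) (hb : 0 < b) (hd : 0 < d) :
    Filter.Tendsto (sigmaFn a b c d) Filter.atTop
      (nhds (Real.sqrt ((-a) * (-c) / (b * d)))) := by
  have h0 : Filter.Tendsto (fun x : ℝ => (x ^ 2)⁻¹) Filter.atTop (nhds 0) :=
    (Filter.tendsto_pow_atTop (two_ne_zero)).inv_tendsto_atTop
  have h1 : Filter.Tendsto (fun x : ℝ => Real.sqrt (((x ^ 2)⁻¹ - a) * ((x ^ 2)⁻¹ - c) /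
      (((x ^ 2)⁻¹ + b) * ((x ^ 2)⁻¹ + d)))) Filter.atTop
      (nhds (Real.sqrt ((0 - a) * (0 - c) / ((0 + b) * (0 + d))))) := by
    refine (Filter.Tendsto.div ?_ ?_ (by simp; exact ⟨hb.ne', hd.ne'⟩)).sqrt
    · exact (h0.sub_const a).mul (h0.sub_const c)
    · exact (h0.add_const b).mul (h0.add_const d)
  simp only [zero_sub, zero_add] at h1
  refine h1.congr' ?_
  filter_upwards [Filter.eventually_gt_atTop 0] with x hx
  unfold sigmaFn
  congr 1
  have : 0 < 1 + b * x ^ 2 := by positivity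
  have : 0 < 1 + d * x ^ 2 := by positivity
  field_simp

lemma sigma_abs (a b c d x : ℝ) : sigmaFn a b c d |x| = sigmaFn a b c d x := by
  simp [sigmaFn, sq_abs]

lemma cos_lip (x y : ℝ) : |Real.cos x - Real.cos y| ≤ |x - y| := by
  have := Real.abs_cos_sub_cos_le x y
  exact this

lemma cos_phase (a b c d : ℝ) (hb : 0 < b) (hd : 0 < d)
    (ε : ℝ) (hε : 0 < ε) :
    ∃ N₀ : ℝ, 1 ≤ N₀ ∧ ∀ N, N₀ ≤ N → ∀ τ, 0 ≤ τ → τ ≤ 1 / (100 * N) → ∀ x : ℝ,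
      N - 1/2 ≤ |x| → |x| ≤ N + 1/2 →
      |Real.cos (x * sigmaFn a b c d x * τ) -
        Real.cos (N * Real.sqrt ((-a) * (-c) / (b * d)) * τ)| ≤ ε := by
  set S := Real.sqrt ((-a) * (-c) / (b * d)) with hS
  have hS0 : 0 ≤ S := Real.sqrt_nonneg _
  obtain ⟨M, hM⟩ := Filter.eventually_atTop.1
    (Metric.tendsto_nhds.1 (sigma_tendsto a b c d hb hd) ε hε)
  refine ⟨max (max 1 (M + 1)) ((S + ε) / ε), le_trans (le_max_left _ _) (le_max_left _ _), ?_⟩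
  intro N hN τ h0 h1 x hx1 hx2
  have hN1 : 1 ≤ N := le_trans (le_trans (le_max_left _ _) (le_max_left _ _)) hN
  have hN2 : M + 1 ≤ N := le_trans (le_trans (le_max_right _ _) (le_max_left _ _)) hN
  have hN3 : (S + ε) / ε ≤ N := le_trans (le_max_right _ _) hN
  rw [div_le_iff₀ hε] at hN3
  have hs := hM |x| (by linarith)
  rw [sigma_abs, Real.dist_eq] at hs
  have e1 : Real.cos (x * sigmaFn a b c d x * τ) = Real.cos (|x| * sigmaFn a b c d x * τ) := by
    rcases abs_cases x with ⟨h, _⟩ | ⟨h, _⟩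
    · rw [h]
    · rw [h, neg_mul, neg_mul, Real.cos_neg]
  rw [e1]
  refine (cos_lip _ _).trans ?_
  have e2 : |x| * sigmaFn a b c d x * τ - N * S * τ =
    ((|x| - N) * sigmaFn a b c d x + N * (sigmaFn a b c d x - S)) * τ := by ring
  rw [e2, abs_mul, abs_of_nonneg h0]
  have hsn : 0 ≤ sigmaFn a b c d x := Real.sqrt_nonneg _
  have hsl : sigmaFn a b c d x ≤ S + ε := by linarith [(abs_lt.1 hs).2]
  have b1 : |(|x| - N) * sigmaFn a b c d x| ≤ 1 * (S + ε) := by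
    rw [abs_mul, abs_of_nonneg hsn]
    have : |(|x| - N)| ≤ 1 := abs_le.2 ⟨by linarith, by linarith⟩
    gcongr
  have b2 : |N * (sigmaFn a b c d x - S)| ≤ N * ε := by
    rw [abs_mul, abs_of_nonneg (by linarith : 0 ≤ N)]
    gcongr
  have b3 := abs_add_le ((|x| - N) * sigmaFn a b c d x) (N * (sigmaFn a b c d x - S))
  calc _ ≤ (2 * (N * ε)) * (1 / (100 * N)) := by
        gcongr
        linarith
    _ ≤ ε := by
        have : (2 * (N * ε)) * (1 / (100 * N)) = ε / 50 := by field_simp; norm_num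
        linarith

lemma bracket_close (a b c d : ℝ) (ha : a < 0) (hc : c < 0) (hb : 0 < b) (hd : 0 < d)
    (ε : ℝ) (hε : 0 < ε) :
    ∃ N₀ : ℝ, 1 ≤ N₀ ∧ ∀ N, N₀ ≤ N → ∀ τ, 0 ≤ τ → τ ≤ 1 / (100 * N) → ∀ ξ x : ℝ, |ξ| ≤ 1 →
      N - 1/2 ≤ |x| → |x| ≤ N + 1/2 → N - 1/2 ≤ |ξ - x| → |ξ - x| ≤ N + 1/2 →
      Real.cos (N * Real.sqrt ((-a) * (-c) / (b * d)) * τ) ^ 2 - ε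
        ≤ bracket a b c d (1 / (100 * N)) τ ξ x := by
  obtain ⟨N1, hN1, H⟩ := cos_phase a b c d hb hd (ε / 4) (by positivity)
  obtain ⟨Ks, hKs0, hKs⟩ := sigma_bound a b c d ha hc hb hd
  obtain ⟨Kc, hKc0, hKc⟩ := coef_bound a b c d ha hc hb hd
  refine ⟨max N1 (max (Ks / (ε / 4)) (Kc * Ks / (ε / 4))), le_trans hN1 (le_max_left _ _), ?_⟩
  intro N hN τ h0 h1 ξ x hξ hx1 hx2 hy1 hy2
  have hNa : N1 ≤ N := le_trans (le_max_left _ _) hN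
  have hNb : Ks / (ε / 4) ≤ N := le_trans (le_trans (le_max_left _ _) (le_max_right _ _)) hN
  have hNc : Kc * Ks / (ε / 4) ≤ N := le_trans (le_trans (le_max_right _ _) (le_max_right _ _)) hN
  rw [div_le_iff₀ (by positivity)] at hNb hNc
  have hNp : 0 < N := by linarith
  have c1 := H N hNa τ h0 h1 x hx1 hx2
  have c2 := H N hNa τ h0 h1 (ξ - x) hy1 hy2
  have hph : |ξ * sigmaFn a b c d ξ * (1 / (100 * N) - τ)| ≤ Ks * (1 / N) := by
    have hsn : 0 ≤ sigmaFn a b c d ξ := Real.sqrt_nonneg _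
    rw [abs_mul, abs_mul, abs_of_nonneg hsn, abs_of_nonneg (by linarith : 0 ≤ 1 / (100 * N) - τ)]
    have : 1 / (100 * N) ≤ 1 / N := by
      apply one_div_le_one_div_of_le hNp; linarith
    calc _ ≤ 1 * Ks * (1 / N) := by
          gcongr
          · exact hKs ξ
          · linarith
      _ = _ := by ring
  have hKsN : Ks * (1 / N) ≤ ε / 4 := by
    rw [mul_one_div, div_le_iff₀ hNp]; linarith
  have hKcN : Kc * (Ks * (1 / N)) ≤ ε / 4 := by
    rw [← mul_assoc, mul_one_div, div_le_iff₀ hNp]; linarith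
  have c0 : |Real.cos (ξ * sigmaFn a b c d ξ * (1 / (100 * N) - τ)) - 1| ≤ ε / 4 := by
    have := cos_lip (ξ * sigmaFn a b c d ξ * (1 / (100 * N) - τ)) 0
    rw [Real.cos_zero, sub_zero] at this
    linarith
  have s0 : |Real.sin (ξ * sigmaFn a b c d ξ * (1 / (100 * N) - τ))| ≤ Ks * (1 / N) :=
    (Real.abs_sin_le_abs).trans hph
  unfold bracket
  have hk := hKc ξ x
  generalize (2 * (1 + d * ξ ^ 2) * hFn a b c d x) / ((1 + b * ξ ^ 2) * hFn a b c d ξ) = k at *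
  generalize hA0 : ξ * sigmaFn a b c d ξ * (1 / (100 * N) - τ) = A0 at *
  generalize x * sigmaFn a b c d x * τ = A1 at *
  generalize (ξ - x) * sigmaFn a b c d (ξ - x) * τ = A2 at *
  generalize N * Real.sqrt ((-a) * (-c) / (b * d)) * τ = A3 at *
  have X : |k * Real.sin A0 * (-Real.sin A1) * Real.cos A2| ≤ ε / 4 := by
    rw [abs_mul, abs_mul, abs_mul, abs_neg]
    calc _ ≤ Kc * (Ks * (1 / N)) * 1 * 1 := by
          have := Real.abs_sin_le_one A1
          have := Real.abs_cos_le_one A2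
          gcongr
      _ ≤ _ := by linarith
  have Y : |Real.cos A0 * Real.cos A1 * Real.cos A2 - Real.cos A3 ^ 2| ≤ 3 * (ε / 4) := by
    have e : Real.cos A0 * Real.cos A1 * Real.cos A2 - Real.cos A3 ^ 2 =
      (Real.cos A0 - 1) * (Real.cos A1 * Real.cos A2) +
      ((Real.cos A1 - Real.cos A3) * Real.cos A2 + (Real.cos A2 - Real.cos A3) * Real.cos A3) := by
      ring
    rw [e]
    have k1 := Real.abs_cos_le_one A1
    have k2 := Real.abs_cos_le_one A2
    have k3 := Real.abs_cos_le_one A3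
    have t1 : |(Real.cos A0 - 1) * (Real.cos A1 * Real.cos A2)| ≤ ε / 4 * (1 * 1) := by
      rw [abs_mul, abs_mul]; gcongr
    have t2 : |(Real.cos A1 - Real.cos A3) * Real.cos A2| ≤ ε / 4 * 1 := by
      rw [abs_mul]; gcongr
    have t3 : |(Real.cos A2 - Real.cos A3) * Real.cos A3| ≤ ε / 4 * 1 := by
      rw [abs_mul]; gcongr
    have u1 := abs_add_le ((Real.cos A0 - 1) * (Real.cos A1 * Real.cos A2))
      ((Real.cos A1 - Real.cos A3) * Real.cos A2 + (Real.cos A2 - Real.cos A3) * Real.cos A3)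
    have u2 := abs_add_le ((Real.cos A1 - Real.cos A3) * Real.cos A2)
      ((Real.cos A2 - Real.cos A3) * Real.cos A3)
    linarith
  linarith [(abs_le.1 X).1, (abs_le.1 Y).1]

lemma bracket_bound (a b c d : ℝ) (ha : a < 0) (hc : c < 0) (hb : 0 < b) (hd : 0 < d) :
    ∃ K : ℝ, 0 ≤ K ∧ ∀ t τ ξ x : ℝ, |bracket a b c d t τ ξ x| ≤ K := by
  obtain ⟨Kc, hKc0, hKc⟩ := coef_bound a b c d ha hc hb hd
  refine ⟨Kc + 1, by positivity, fun t τ ξ x => ?_⟩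
  unfold bracket
  have hk := hKc ξ x
  generalize (2 * (1 + d * ξ ^ 2) * hFn a b c d x) / ((1 + b * ξ ^ 2) * hFn a b c d ξ) = k at *
  generalize ξ * sigmaFn a b c d ξ * (t - τ) = A0 at *
  generalize x * sigmaFn a b c d x * τ = A1 at *
  generalize (ξ - x) * sigmaFn a b c d (ξ - x) * τ = A2 at *
  refine (abs_add_le _ _).trans ?_
  simp only [abs_mul, abs_neg]
  have e1 : Kc + 1 = Kc * 1 * 1 * 1 + 1 * 1 * 1 := by ring
  rw [e1]
  have h1 := Real.abs_sin_le_one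
  have h2 := Real.abs_cos_le_one
  gcongr <;> first | exact h1 _ | exact h2 _

def AN (N : ℝ) : Set ℝ := {ξ : ℝ | N - 1/2 ≤ |ξ| ∧ |ξ| ≤ N + 1/2}

lemma AN_meas (N : ℝ) : MeasurableSet (AN N) :=
  (measurableSet_le measurable_const measurable_id.abs).inter
    (measurableSet_le measurable_id.abs measurable_const)

lemma AN_sub (N : ℝ) : AN N ⊆ Set.Icc (N - 1/2) (N + 1/2) ∪ Set.Icc (-(N + 1/2)) (-(N - 1/2)) := by
  rintro x ⟨h1, h2⟩
  rcases abs_cases x with ⟨h, _⟩ | ⟨h, _⟩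
  · left; exact ⟨by linarith, by linarith⟩
  · right; exact ⟨by linarith, by linarith⟩

lemma AN_vol (N : ℝ) : volume (AN N) ≤ 2 := by
  refine (measure_mono (AN_sub N)).trans ((measure_union_le _ _).trans ?_)
  rw [Real.volume_Icc, Real.volume_Icc]
  ring_nf
  norm_num

lemma AN_fin (N : ℝ) : volume (AN N) ≠ ⊤ := ne_top_of_le_ne_top (by simp) (AN_vol N)

lemma AN_ge (N : ℝ) (hN : 1 ≤ N) : Set.Icc (N - 1/2) (N + 1/2) ⊆ AN N := by
  rintro x ⟨h1, h2⟩
  have : |x| = x := abs_of_nonneg (by linarith)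
  exact ⟨by rw [this]; exact h1, by rw [this]; exact h2⟩

lemma uhat_eq (s N x : ℝ) : uhat s N x = (AN N).indicator (fun _ => N ^ (-s)) x := by
  unfold uhat
  change N ^ (-s) * (AN N).indicator _ x = _
  by_cases h : x ∈ AN N <;> simp [h]

lemma uhat_meas (s N : ℝ) : Measurable (uhat s N) := by
  have : uhat s N = (AN N).indicator (fun _ => N ^ (-s)) := funext (uhat_eq s N)
  rw [this]
  exact measurable_const.indicator (AN_meas N)

lemma sigma_meas (a b c d : ℝ) : Measurable (sigmaFn a b c d) := by
  unfold sigmaFn; fun_prop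

lemma h_meas (a b c d : ℝ) : Measurable (hFn a b c d) := by
  unfold hFn; fun_prop

lemma F_meas (a b c d s N : ℝ) : Measurable (fun p : (ℝ × ℝ) × ℝ =>
    bracket a b c d (1 / (100 * N)) p.1.2 p.1.1 p.2 * uhat s N p.2 * uhat s N (p.1.1 - p.2)) := by
  have := uhat_meas s N
  have := sigma_meas a b c d
  have := h_meas a b c d
  unfold bracket
  fun_prop

lemma Iint_meas (a b c d s N : ℝ) : Measurable (Iint a b c d s N) := by
  have h1 := (F_meas a b c d s N).stronglyMeasurable.integral_prod_right' (ν := volume)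
  have h2 := h1.integral_prod_right' (ν := volume.restrict (Set.Icc (0:ℝ) (1 / (100 * N))))
  exact h2.measurable

lemma F_dom (a b c d s N K : ℝ) (hN : 0 < N) (hK : ∀ t τ ξ x : ℝ, |bracket a b c d t τ ξ x| ≤ K)
    (τ ξ x : ℝ) :
    ‖bracket a b c d (1 / (100 * N)) τ ξ x * uhat s N x * uhat s N (ξ - x)‖ ≤
      (AN N).indicator (fun _ => K * N ^ (-s) * N ^ (-s)) x := by
  rw [uhat_eq, uhat_eq, Real.norm_eq_abs, abs_mul, abs_mul]
  have hp : 0 ≤ N ^ (-s) := by positivity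
  have hk := hK (1 / (100 * N)) τ ξ x
  have hK0 : 0 ≤ K := (abs_nonneg _).trans hk
  by_cases h : x ∈ AN N
  · by_cases h' : ξ - x ∈ AN N
    · simp only [h, h', Set.indicator_of_mem, abs_of_nonneg hp]
      gcongr
    · simp only [h, h', Set.indicator_of_mem, Set.indicator_of_notMem, not_false_eq_true, abs_zero,
        mul_zero]
      positivity
  · simp [h]

lemma ind_int (N C : ℝ) : Integrable ((AN N).indicator (fun _ => C)) volume :=
  (integrable_indicator_iff (AN_meas N)).2 (integrableOn_const (AN_fin N))

lemma F_int (a b c d s N K : ℝ) (hN : 0 < N) (hK : ∀ t τ ξ x : ℝ, |bracket a b c d t τ ξ x| ≤ K)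
    (τ ξ : ℝ) :
    Integrable (fun x => bracket a b c d (1 / (100 * N)) τ ξ x * uhat s N x * uhat s N (ξ - x)) := by
  refine (ind_int N (K * N ^ (-s) * N ^ (-s))).mono' ?_
    (Filter.Eventually.of_forall (F_dom a b c d s N K hN hK τ ξ))
  exact ((F_meas a b c d s N).comp (measurable_prodMk_left (x := (ξ, τ)))).aestronglyMeasurable

lemma inner_bd (a b c d s N K : ℝ) (hN : 0 < N)
    (hK : ∀ t τ ξ x : ℝ, |bracket a b c d t τ ξ x| ≤ K) (τ ξ : ℝ) :
    ‖∫ x, bracket a b c d (1 / (100 * N)) τ ξ x * uhat s N x * uhat s N (ξ - x)‖ ≤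
      ∫ x, (AN N).indicator (fun _ => K * N ^ (-s) * N ^ (-s)) x :=
  norm_integral_le_of_norm_le (ind_int N _)
    (Filter.Eventually.of_forall (F_dom a b c d s N K hN hK τ ξ))

lemma inner_meas (a b c d s N ξ : ℝ) : Measurable (fun τ =>
    ∫ x, bracket a b c d (1 / (100 * N)) τ ξ x * uhat s N x * uhat s N (ξ - x)) := by
  have h0 : Measurable (fun p : ℝ × ℝ =>
      bracket a b c d (1 / (100 * N)) p.1 ξ p.2 * uhat s N p.2 * uhat s N (ξ - p.2)) := by
    have := uhat_meas s N
    have := sigma_meas a b c d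
    have := h_meas a b c d
    unfold bracket
    fun_prop
  have h1 := h0.stronglyMeasurable
  exact (h1.integral_prod_right' (ν := volume)).measurable

lemma inner_int (a b c d s N K : ℝ) (hN : 0 < N)
    (hK : ∀ t τ ξ x : ℝ, |bracket a b c d t τ ξ x| ≤ K) (ξ : ℝ) :
    IntegrableOn (fun τ =>
      ∫ x, bracket a b c d (1 / (100 * N)) τ ξ x * uhat s N x * uhat s N (ξ - x))
      (Set.Icc (0:ℝ) (1 / (100 * N))) := by
  refine Integrable.mono' (integrableOn_const (C := ∫ x, (AN N).indicator
    (fun _ => K * N ^ (-s) * N ^ (-s)) x) (by simp)) (inner_meas a b c d s N ξ).aestronglyMeasurable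
    (Filter.Eventually.of_forall (fun τ => inner_bd a b c d s N K hN hK τ ξ))

lemma Iint_bd (a b c d s N K : ℝ) (hN : 0 < N)
    (hK : ∀ t τ ξ x : ℝ, |bracket a b c d t τ ξ x| ≤ K) :
    ∃ C, ∀ ξ, |Iint a b c d s N ξ| ≤ C := by
  refine ⟨∫ _ in Set.Icc (0:ℝ) (1 / (100 * N)), ∫ x, (AN N).indicator
    (fun _ => K * N ^ (-s) * N ^ (-s)) x, fun ξ => ?_⟩
  exact norm_integral_le_of_norm_le
    (μ := volume.restrict (Set.Icc (0:ℝ) (1 / (100 * N))))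
    (integrableOn_const (C := ∫ x, (AN N).indicator
    (fun _ => K * N ^ (-s) * N ^ (-s)) x) (by simp))
    (Filter.Eventually.of_forall (fun τ => inner_bd a b c d s N K hN hK τ ξ))

lemma cos_int (S N : ℝ) (hN : 0 < N) :
    ∫ τ in Set.Icc (0:ℝ) (1 / (100 * N)), Real.cos (N * S * τ) ^ 2 =
      (∫ r in (0:ℝ)..1, Real.cos (S / 100 * r) ^ 2) * (1 / (100 * N)) := by
  rw [integral_Icc_eq_integral_Ioc, ← intervalIntegral.integral_of_le (by positivity)]
  have h := intervalIntegral.integral_comp_mul_left (a := 0) (b := 1 / (100 * N))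
    (fun r => Real.cos (S / 100 * r) ^ 2) (c := 100 * N) (by positivity)
  have e : ∀ τ, Real.cos (S / 100 * (100 * N * τ)) ^ 2 = Real.cos (N * S * τ) ^ 2 := by
    intro τ; congr 2; ring
  simp only [e] at h
  rw [h, mul_zero, mul_one_div_cancel (by positivity), smul_eq_mul, one_div]
  ring

lemma m_pos (S : ℝ) : 0 < ∫ r in (0:ℝ)..1, Real.cos (S / 100 * r) ^ 2 := by
  refine intervalIntegral.integral_pos zero_lt_one (by fun_prop) (fun x _ => by positivity)
    ⟨0, by simp, by simp⟩

lemma Iint_lower (a b c d s : ℝ) (ha : a < 0) (hc : c < 0) (hb : 0 < b) (hd : 0 < d) :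
    ∃ κ > (0:ℝ), ∃ N₀ : ℝ, 1 ≤ N₀ ∧ ∀ N, N₀ ≤ N → ∀ ξ ∈ Set.Icc (1/4:ℝ) (1/2),
      κ * N ^ (-2 * s - 1) ≤ Iint a b c d s N ξ := by
  set S := Real.sqrt ((-a) * (-c) / (b * d)) with hS
  have hm := m_pos S
  set m := ∫ r in (0:ℝ)..1, Real.cos (S / 100 * r) ^ 2 with hmdef
  obtain ⟨N₀, hN₀, H⟩ := bracket_close a b c d ha hc hb hd (m / 2) (by positivity)
  obtain ⟨K, hK0, hK⟩ := bracket_bound a b c d ha hc hb hd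
  refine ⟨m / 400, by positivity, N₀, hN₀, fun N hN ξ hξ => ?_⟩
  have hN1 : 1 ≤ N := hN₀.trans hN
  have hNp : 0 < N := by linarith
  have hp : 0 < N ^ (-s) := by positivity
  have hξ1 : |ξ| ≤ 1 := abs_le.2 ⟨by linarith [hξ.1], by linarith [hξ.2]⟩
  set T : Set ℝ := AN N ∩ (fun x => ξ - x) ⁻¹' (AN N) with hT
  have hTm : MeasurableSet T := (AN_meas N).inter ((measurable_const.sub measurable_id) (AN_meas N))
  have hTf : volume T ≠ ⊤ := ne_top_of_le_ne_top (AN_fin N) (measure_mono Set.inter_subset_left)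
  have hTv : 1/2 ≤ volume.real T := by
    have hsub : Set.Icc N (N + 1/2) ⊆ T := by
      rintro x ⟨h1, h2⟩
      refine ⟨AN_ge N hN1 ⟨by linarith, h2⟩, ?_⟩
      have : |ξ - x| = x - ξ := by rw [abs_sub_comm]; exact abs_of_nonneg (by linarith [hξ.2])
      constructor
      · show _ ≤ |ξ - x|
        rw [this]; linarith [hξ.2]
      · show |ξ - x| ≤ _
        rw [this]; linarith [hξ.1]
    have := measureReal_mono hsub hTf
    rw [Real.volume_real_Icc_of_le (by linarith)] at this
    linarith
  set V := volume.real T with hV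
  have hinner : ∀ τ ∈ Set.Icc (0:ℝ) (1 / (100 * N)),
      (Real.cos (N * S * τ) ^ 2 - m / 2) * (N ^ (-s) * N ^ (-s) * V) ≤
      ∫ x, bracket a b c d (1 / (100 * N)) τ ξ x * uhat s N x * uhat s N (ξ - x) := by
    intro τ hτ
    have e : (Real.cos (N * S * τ) ^ 2 - m / 2) * (N ^ (-s) * N ^ (-s) * V) =
      ∫ x, T.indicator (fun _ => (Real.cos (N * S * τ) ^ 2 - m / 2) * (N ^ (-s) * N ^ (-s))) x := by
      rw [integral_indicator hTm, setIntegral_const, smul_eq_mul]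
      ring
    rw [e]
    refine integral_mono ((integrable_indicator_iff hTm).2 (integrableOn_const hTf))
      (F_int a b c d s N K hNp hK τ ξ) (fun x => ?_)
    simp only [uhat_eq]
    by_cases h : x ∈ AN N
    · by_cases h' : ξ - x ∈ AN N
      · have hx : x ∈ T := ⟨h, h'⟩
        simp only [h, h', hx, Set.indicator_of_mem]
        rw [mul_assoc (bracket _ _ _ _ _ _ _ _)]
        have := H N hN τ hτ.1 hτ.2 ξ x hξ1 h.1 h.2 h'.1 h'.2
        gcongr
      · have hx : x ∉ T := fun hx => h' hx.2
        simp [h', hx]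
    · have hx : x ∉ T := fun hx => h hx.1
      simp [h, hx]
  have hci : IntegrableOn (fun τ => Real.cos (N * S * τ) ^ 2) (Set.Icc (0:ℝ) (1 / (100 * N))) :=
    Continuous.integrableOn_Icc (by fun_prop)
  have hcc : IntegrableOn (fun _ : ℝ => m / 2) (Set.Icc (0:ℝ) (1 / (100 * N))) :=
    integrableOn_const (by simp)
  have hI : ∫ τ in Set.Icc (0:ℝ) (1 / (100 * N)),
      (Real.cos (N * S * τ) ^ 2 - m / 2) * (N ^ (-s) * N ^ (-s) * V) ≤ Iint a b c d s N ξ :=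
    setIntegral_mono_on ((hci.sub hcc).mul_const _)
      (inner_int a b c d s N K hNp hK ξ) measurableSet_Icc hinner
  rw [integral_mul_const, integral_sub hci hcc, cos_int S N hNp, setIntegral_const,
    Real.volume_real_Icc_of_le (by positivity), smul_eq_mul, ← hmdef] at hI
  refine le_trans ?_ hI
  have e : N ^ (-2 * s - 1) = N ^ (-s) * N ^ (-s) * (1 / N) := by
    rw [← Real.rpow_add hNp, one_div, ← Real.rpow_neg_one N, ← Real.rpow_add hNp]
    congr 1; ring
  rw [e]
  have e2 : (m * (1 / (100 * N)) - (1 / (100 * N) - 0) * (m / 2)) * (N ^ (-s) * N ^ (-s) * V) =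
    m / 200 * (N ^ (-s) * N ^ (-s) * (1 / N)) * V := by
    field_simp
    norm_num
  rw [e2]
  have : 0 ≤ m / 200 * (N ^ (-s) * N ^ (-s) * (1 / N)) := by positivity
  nlinarith

lemma part1 (a b c d : ℝ) (ha : a < 0) (hc : c < 0) (hb : 0 < b) (hd : 0 < d) (s s' : ℝ) :
    (∃ κ > (0:ℝ), ∃ N₀ : ℝ, ∀ N : ℝ, N₀ ≤ N →
      κ * N ^ (-2 * s - 1) ≤
        Real.sqrt (∫ ξ in {ξ : ℝ | |ξ| ≤ 1},
          (1 + ξ ^ 2) ^ s' * (ξ / (2 * (1 + d * ξ ^ 2))) ^ 2 * (Iint a b c d s N ξ) ^ 2)) := by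
  obtain ⟨κ, hκ, N₀, hN₀, H⟩ := Iint_lower a b c d s ha hc hb hd
  obtain ⟨K, hK0, hK⟩ := bracket_bound a b c d ha hc hb hd
  have hset : {ξ : ℝ | |ξ| ≤ 1} = Set.Icc (-1) 1 := by ext x; simp [abs_le]
  -- the weight
  set w : ℝ → ℝ := fun ξ => (1 + ξ ^ 2) ^ s' * (ξ / (2 * (1 + d * ξ ^ 2))) ^ 2 with hw
  have hwc : Continuous w := by
    refine Continuous.mul ?_ (Continuous.pow (Continuous.div (by fun_prop) (by fun_prop) ?_) 2)
    · exact Continuous.rpow_const (by fun_prop) (fun x => Or.inl (by positivity))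
    · intro x; positivity
  have hw0 : ∀ ξ, 0 ≤ w ξ := fun ξ => by positivity
  set W := ∫ ξ in Set.Icc (1/4:ℝ) (1/2), w ξ with hW
  have hWp : 0 < W := by
    rw [hW, integral_Icc_eq_integral_Ioc, ← intervalIntegral.integral_of_le (by norm_num)]
    refine intervalIntegral.integral_pos (by norm_num) hwc.continuousOn (fun x _ => hw0 x)
      ⟨1/2, by norm_num, by simp only [hw]; positivity⟩
  refine ⟨κ * Real.sqrt W, by positivity, N₀, fun N hN => ?_⟩
  have hNp : 0 < N := by linarith
  have hp : 0 < N ^ (-2 * s - 1) := by positivity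
  obtain ⟨C, hC⟩ := Iint_bd a b c d s N K hNp hK
  have hwi : IntegrableOn w (Set.Icc (-1:ℝ) 1) := hwc.integrableOn_Icc
  have hint : IntegrableOn (fun ξ => w ξ * (Iint a b c d s N ξ) ^ 2) (Set.Icc (-1:ℝ) 1) := by
    refine Integrable.mono' (hwi.mul_const (C ^ 2))
      (hwc.measurable.mul ((Iint_meas a b c d s N).pow_const 2)).aestronglyMeasurable
      (Filter.Eventually.of_forall fun ξ => ?_)
    rw [Real.norm_eq_abs, abs_of_nonneg (mul_nonneg (hw0 ξ) (sq_nonneg _))]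
    refine mul_le_mul_of_nonneg_left ?_ (hw0 ξ)
    exact sq_le_sq' (abs_le.1 (hC ξ)).1 (abs_le.1 (hC ξ)).2
  apply Real.le_sqrt_of_sq_le
  rw [hset]
  have hsub : Set.Icc (1/4:ℝ) (1/2) ⊆ Set.Icc (-1:ℝ) 1 :=
    Set.Icc_subset_Icc (by norm_num) (by norm_num)
  calc (κ * Real.sqrt W * N ^ (-2 * s - 1)) ^ 2 = W * (κ * N ^ (-2 * s - 1)) ^ 2 := by
        rw [mul_right_comm, mul_pow, Real.sq_sqrt hWp.le]; ring
    _ = ∫ ξ in Set.Icc (1/4:ℝ) (1/2), w ξ * (κ * N ^ (-2 * s - 1)) ^ 2 := by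
        rw [integral_mul_const]
    _ ≤ ∫ ξ in Set.Icc (1/4:ℝ) (1/2), w ξ * (Iint a b c d s N ξ) ^ 2 := by
        refine setIntegral_mono_on ((hwi.mono_set hsub).mul_const _) (hint.mono_set hsub)
          measurableSet_Icc (fun ξ hξ => ?_)
        refine mul_le_mul_of_nonneg_left ?_ (hw0 ξ)
        have := H N hN ξ hξ
        gcongr
    _ ≤ ∫ ξ in Set.Icc (-1:ℝ) 1, w ξ * (Iint a b c d s N ξ) ^ 2 := by
        refine setIntegral_mono_set hint
          (Filter.Eventually.of_forall fun ξ => mul_nonneg (hw0 ξ) (sq_nonneg _))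
          (Filter.Eventually.of_forall hsub)

lemma part3 (s : ℝ) (hs : s < -1/2) :
    (∃ c₁ C₁ : ℝ, 0 < c₁ ∧ c₁ ≤ C₁ ∧ ∀ N : ℝ, 1 ≤ N →
      c₁ ≤ Real.sqrt (∫ ξ : ℝ, (1 + ξ ^ 2) ^ s * (uhat s N ξ) ^ 2) ∧
      Real.sqrt (∫ ξ : ℝ, (1 + ξ ^ 2) ^ s * (uhat s N ξ) ^ 2) ≤ C₁) := by
  have key : ∀ N : ℝ, 1 ≤ N →
      Real.sqrt ((4:ℝ) ^ s) ≤ Real.sqrt (∫ ξ : ℝ, (1 + ξ ^ 2) ^ s * (uhat s N ξ) ^ 2) ∧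
      Real.sqrt (∫ ξ : ℝ, (1 + ξ ^ 2) ^ s * (uhat s N ξ) ^ 2) ≤
        Real.sqrt ((1/4:ℝ) ^ s * 2) := by
    intro N hN
    have hNp : 0 < N := by linarith
    have e0 : ∀ ξ, (1 + ξ ^ 2) ^ s * (uhat s N ξ) ^ 2 =
        (AN N).indicator (fun ξ => (1 + ξ ^ 2) ^ s * (N ^ 2) ^ (-s)) ξ := by
      intro ξ
      rw [uhat_eq]
      by_cases h : ξ ∈ AN N
      · simp only [h, Set.indicator_of_mem]
        congr 1
        rw [← Real.rpow_natCast, ← Real.rpow_natCast, ← Real.rpow_mul hNp.le,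
          ← Real.rpow_mul hNp.le, mul_comm]
      · simp [h]
    simp only [e0]
    rw [integral_indicator (AN_meas N)]
    have hcancel : (N ^ 2) ^ s * (N ^ 2) ^ (-s) = 1 := by
      rw [← Real.rpow_add (by positivity)]; simp
    have hNs : 0 < (N ^ 2) ^ (-s) := by positivity
    have bds : ∀ ξ ∈ AN N, (4:ℝ) ^ s ≤ (1 + ξ ^ 2) ^ s * (N ^ 2) ^ (-s) ∧
        (1 + ξ ^ 2) ^ s * (N ^ 2) ^ (-s) ≤ (1/4:ℝ) ^ s := by
      rintro ξ ⟨h1, h2⟩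
      have u : 1 + ξ ^ 2 ≤ 4 * N ^ 2 := by
        rw [← sq_abs]; nlinarith [abs_nonneg ξ]
      have l : 1/4 * N ^ 2 ≤ 1 + ξ ^ 2 := by
        rw [← sq_abs ξ]; nlinarith [abs_nonneg ξ]
      constructor
      · calc (4:ℝ) ^ s = (4 * N ^ 2) ^ s * (N ^ 2) ^ (-s) := by
              rw [Real.mul_rpow (by norm_num) (by positivity), mul_assoc, hcancel, mul_one]
          _ ≤ _ := mul_le_mul_of_nonneg_right
              (Real.rpow_le_rpow_of_nonpos (by positivity) u (by linarith)) hNs.le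
      · calc (1 + ξ ^ 2) ^ s * (N ^ 2) ^ (-s) ≤ (1/4 * N ^ 2) ^ s * (N ^ 2) ^ (-s) :=
              mul_le_mul_of_nonneg_right
              (Real.rpow_le_rpow_of_nonpos (by positivity) l (by linarith)) hNs.le
          _ = _ := by
              rw [Real.mul_rpow (by norm_num) (by positivity), mul_assoc, hcancel, mul_one]
    have hc1 : IntegrableOn (fun _ : ℝ => (4:ℝ) ^ s) (AN N) := integrableOn_const (AN_fin N)
    have hc2 : IntegrableOn (fun _ : ℝ => (1/4:ℝ) ^ s) (AN N) := integrableOn_const (AN_fin N)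
    have hint : IntegrableOn (fun ξ : ℝ => (1 + ξ ^ 2) ^ s * (N ^ 2) ^ (-s)) (AN N) := by
      refine Integrable.mono' hc2 (Measurable.aestronglyMeasurable (by fun_prop)) ?_
      refine (ae_restrict_iff' (AN_meas N)).2 (Filter.Eventually.of_forall fun ξ hξ => ?_)
      rw [Real.norm_eq_abs, abs_of_nonneg (by positivity)]
      exact (bds ξ hξ).2
    constructor
    · apply Real.sqrt_le_sqrt
      have h := setIntegral_mono_on hc1 hint (AN_meas N) (fun ξ hξ => (bds ξ hξ).1)
      rw [setIntegral_const, smul_eq_mul] at h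
      have hv := measureReal_mono (AN_ge N hN) (AN_fin N)
      rw [Real.volume_real_Icc_of_le (by linarith)] at hv
      have : (0:ℝ) < 4 ^ s := by positivity
      nlinarith
    · apply Real.sqrt_le_sqrt
      have h := setIntegral_mono_on hint hc2 (AN_meas N) (fun ξ hξ => (bds ξ hξ).2)
      rw [setIntegral_const, smul_eq_mul] at h
      have hv : volume.real (AN N) ≤ 2 := by
        have := ENNReal.toReal_mono (by simp) (AN_vol N)
        simpa [Measure.real] using this
      have : (0:ℝ) < (1/4) ^ s := by positivity
      nlinarith
  exact ⟨_, _, Real.sqrt_pos.2 (by positivity), (key 1 le_rfl).1.trans (key 1 le_rfl).2, key⟩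

end St16

theorem stmt_16 (a b c d : ℝ) (ha : a < 0) (hc : c < 0) (hb : 0 < b) (hd : 0 < d)
    (s s' : ℝ) (hs : s < -1/2) :
    (∃ κ > (0:ℝ), ∃ N₀ : ℝ, ∀ N : ℝ, N₀ ≤ N →
      κ * N ^ (-2 * s - 1) ≤
        Real.sqrt (∫ ξ in {ξ : ℝ | |ξ| ≤ 1},
          (1 + ξ ^ 2) ^ s' * (ξ / (2 * (1 + d * ξ ^ 2))) ^ 2 * (Iint a b c d s N ξ) ^ 2)) ∧
    Filter.Tendsto (fun N : ℝ => N ^ (-2 * s - 1)) Filter.atTop Filter.atTop ∧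
    (∃ c₁ C₁ : ℝ, 0 < c₁ ∧ c₁ ≤ C₁ ∧ ∀ N : ℝ, 1 ≤ N →
      c₁ ≤ Real.sqrt (∫ ξ : ℝ, (1 + ξ ^ 2) ^ s * (uhat s N ξ) ^ 2) ∧
      Real.sqrt (∫ ξ : ℝ, (1 + ξ ^ 2) ^ s * (uhat s N ξ) ^ 2) ≤ C₁) := by
  refine ⟨St16.part1 a b c d ha hc hb hd s s', ?_, St16.part3 s hs⟩
  exact tendsto_rpow_atTop (by linarith)
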